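/- Let F = ℤ/5, let ζ be a unit of F, and let Q_ζ : F³ → F be the quadratic form Q_ζ(x, y, z) = 2ζ(x² + y² + z² + xy + yz + zx). Then the even subalgebra of the Clifford algebra Cl(Q_ζ) is isomorphic as an F-algebra to the algebra of 2×2 matrices over F. -/

import Mathlib

open CliffordAlgebra

section EvenSpan

variable {R A : Type*} [CommRing R] [Ring A] [Algebra R A]

/-- The span of the even ordered monomials in three elements. -/
def evenMonomialSpan (R : Type*) {A : Type*} [CommRing R] [Ring A] [Algebra R A] (u : Fin 3 → A) :
    Submodule R A :=
  Submodule.span R (Set.range ![1, u 0 * u 1, u 0 * u 2, u 1 * u 2])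

/-- The span of the odd ordered monomials in three elements. -/
def oddMonomialSpan (R : Type*) {A : Type*} [CommRing R] [Ring A] [Algebra R A] (u : Fin 3 → A) :
    Submodule R A :=
  Submodule.span R (Set.range ![u 0, u 1, u 2, u 0 * (u 1 * u 2)])

theorem mul_reassoc_of_eq_smul_one {a : A} {r : R} (h : a * a = r • 1) (x : A) :
    a * (a * x) = r • x := by
  rw [← mul_assoc, h, smul_one_mul]

theorem mul_reassoc_of_eq_smul_one_sub {a b : A} {r : R} (h : b * a = r • 1 - a * b) (x : A) :
    b * (a * x) = r • x - a * (b * x) := by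
  rw [← mul_assoc, h, sub_mul, smul_one_mul, mul_assoc]

variable {u : Fin 3 → A} {q : Fin 3 → R} {p : Fin 3 → Fin 3 → R}

theorem mul_mem_oddMonomialSpan (hq : ∀ i, u i * u i = q i • 1)
    (hp : ∀ i j, u j * u i = p i j • 1 - u i * u j) (i : Fin 3) {x : A}
    (hx : x ∈ evenMonomialSpan R u) : u i * x ∈ oddMonomialSpan R u := by
  have h (k : Fin 4) : ![u 0, u 1, u 2, u 0 * (u 1 * u 2)] k ∈ oddMonomialSpan R u :=
    Submodule.subset_span ⟨k, rfl⟩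
  have h0 := h 0
  have h1 := h 1
  have h2 := h 2
  have h3 := h 3
  simp only [Matrix.cons_val] at h0 h1 h2 h3
  suffices evenMonomialSpan R u ≤ (oddMonomialSpan R u).comap (LinearMap.mulLeft R (u i)) from
    this hx
  refine Submodule.span_le.2 ?_
  rintro _ ⟨k, rfl⟩
  fin_cases i <;> fin_cases k <;>
    simp [hq, hp 1 2, mul_reassoc_of_eq_smul_one (hq _),
      mul_reassoc_of_eq_smul_one_sub (hp 0 1), mul_reassoc_of_eq_smul_one_sub (hp 0 2),
      mul_reassoc_of_eq_smul_one_sub (hp 1 2), mul_sub] <;>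
    first
    | assumption
    | (repeat' first | assumption | apply Submodule.sub_mem | apply Submodule.smul_mem)

theorem mul_mem_evenMonomialSpan (hq : ∀ i, u i * u i = q i • 1)
    (hp : ∀ i j, u j * u i = p i j • 1 - u i * u j) (i : Fin 3) {x : A}
    (hx : x ∈ oddMonomialSpan R u) : u i * x ∈ evenMonomialSpan R u := by
  have h (k : Fin 4) : ![1, u 0 * u 1, u 0 * u 2, u 1 * u 2] k ∈ evenMonomialSpan R u :=
    Submodule.subset_span ⟨k, rfl⟩
  have h0 := h 0
  have h1 := h 1
  have h2 := h 2
  have h3 := h 3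
  simp only [Matrix.cons_val] at h0 h1 h2 h3
  suffices oddMonomialSpan R u ≤ (evenMonomialSpan R u).comap (LinearMap.mulLeft R (u i)) from
    this hx
  refine Submodule.span_le.2 ?_
  rintro _ ⟨k, rfl⟩
  fin_cases i <;> fin_cases k <;>
    simp [hq, hp 0 1, hp 0 2, hp 1 2, mul_reassoc_of_eq_smul_one (hq _),
      mul_reassoc_of_eq_smul_one_sub (hp 0 1), mul_reassoc_of_eq_smul_one_sub (hp 0 2),
      mul_reassoc_of_eq_smul_one_sub (hp 1 2), mul_sub] <;>
    first
    | assumption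
    | (repeat' first | assumption | apply Submodule.sub_mem | apply Submodule.smul_mem)

end EvenSpan

theorem CliffordAlgebra.evenOdd_zero_le_evenMonomialSpan {R : Type*} [CommRing R]
    (Q : QuadraticForm R (Fin 3 → R)) :
    evenOdd Q 0 ≤ evenMonomialSpan R fun i => ι Q (Pi.single i 1) := by
  set u : Fin 3 → CliffordAlgebra Q := fun i => ι Q (Pi.single i 1) with hu
  have hq (i : Fin 3) : u i * u i = Q (Pi.single i 1) • 1 := by
    rw [hu, ι_sq_scalar, Algebra.algebraMap_eq_smul_one]
  have hp (i j : Fin 3) :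
      u j * u i = QuadraticMap.polar Q (Pi.single i 1) (Pi.single j 1) • 1 - u i * u j := by
    rw [← Algebra.algebraMap_eq_smul_one, ← ι_mul_ι_add_swap]
    simp [hu]
  have hm (m : Fin 3 → R) : ι Q m = ∑ i, m i • u i := by
    conv_lhs => rw [pi_eq_sum_univ' m]
    simp [hu, map_sum, map_smul]
  have odd_mem (m : Fin 3 → R) {x} (hx : x ∈ evenMonomialSpan R u) :
      ι Q m * x ∈ oddMonomialSpan R u := by
    rw [hm, Finset.sum_mul]
    refine Submodule.sum_mem _ fun i _ => ?_
    rw [smul_mul_assoc]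
    exact Submodule.smul_mem _ _ (mul_mem_oddMonomialSpan hq hp i hx)
  have even_mem (m : Fin 3 → R) {x} (hx : x ∈ oddMonomialSpan R u) :
      ι Q m * x ∈ evenMonomialSpan R u := by
    rw [hm, Finset.sum_mul]
    refine Submodule.sum_mem _ fun i _ => ?_
    rw [smul_mul_assoc]
    exact Submodule.smul_mem _ _ (mul_mem_evenMonomialSpan hq hp i hx)
  intro x hx
  induction x, hx using even_induction with
  | algebraMap r =>
    rw [Algebra.algebraMap_eq_smul_one]
    exact Submodule.smul_mem _ _ (Submodule.subset_span ⟨0, rfl⟩)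
  | add x y _ _ ihx ihy => exact Submodule.add_mem _ ihx ihy
  | ι_mul_ι_mul m₁ m₂ x _ ih =>
    rw [mul_assoc]
    exact even_mem m₁ (odd_mem m₂ ih)

/-- A linear map whose square is proportional to `Q` induces an `EvenHom`. -/
@[simps]
def CliffordAlgebra.EvenHom.ofScaledSq {R M A : Type*} [CommRing R] [AddCommGroup M] [Module R M]
    [Ring A] [Algebra R A] {Q : QuadraticForm R M} (c : R) (g : M →ₗ[R] A)
    (hg : ∀ m, c • (g m * g m) = Q m • 1) : EvenHom Q A where
  bilin := c • (LinearMap.mul R A).compl₁₂ g g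
  contract m := by simpa [Algebra.algebraMap_eq_smul_one] using hg m
  contract_mid m₁ m₂ m₃ := by
    calc (c • (g m₁ * g m₂)) * (c • (g m₂ * g m₃))
        = c • (g m₁ * (c • (g m₂ * g m₂)) * g m₃) := by
          simp only [smul_mul_assoc, mul_smul_comm, mul_assoc]
      _ = Q m₂ • (c • (g m₁ * g m₃)) := by
          rw [hg, mul_smul_comm, mul_one, smul_mul_assoc, smul_comm]

theorem CliffordAlgebra.finite_even_and_finrank_even_le_four {K : Type*} [Field K]
    (Q : QuadraticForm K (Fin 3 → K)) :
    Module.Finite K (even Q) ∧ Module.finrank K (even Q) ≤ 4 := by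
  have hle := evenOdd_zero_le_evenMonomialSpan Q
  have : Module.Finite K (evenMonomialSpan K fun i => ι Q (Pi.single i 1)) :=
    Module.Finite.span_of_finite K (Set.finite_range _)
  refine ⟨Submodule.finiteDimensional_of_le hle, (Submodule.finrank_mono hle).trans ?_⟩
  exact (finrank_range_le_card (R := K) _).trans_eq (Fintype.card_fin 4)

/-- Three trace-zero matrices whose span realises twice the form
`x² + y² + z² + xy + yz + zx` by squaring. -/
def traceZeroMap : (Fin 3 → ZMod 5) →ₗ[ZMod 5] Matrix (Fin 2) (Fin 2) (ZMod 5) :=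
  Fintype.linearCombination (ZMod 5) ![!![0, 1; 2, 0], !![1, 2; 3, 4], !![1, 4; 4, 4]]

theorem traceZeroMap_mul_self (v : Fin 3 → ZMod 5) :
    traceZeroMap v * traceZeroMap v =
      (2 * (v 0 ^ 2 + v 1 ^ 2 + v 2 ^ 2 + v 0 * v 1 + v 1 * v 2 + v 2 * v 0)) •
        (1 : Matrix (Fin 2) (Fin 2) (ZMod 5)) := by
  ext i j
  fin_cases i <;> fin_cases j <;>
    simp [traceZeroMap, Fintype.linearCombination_apply, Fin.sum_univ_three, Matrix.mul_apply] <;>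
    ring_nf <;> reduce_mod_char

theorem exists_eq_combination_traceZeroMap (M : Matrix (Fin 2) (Fin 2) (ZMod 5)) :
    ∃ a b c d : ZMod 5, a • 1
      + b • (traceZeroMap (Pi.single 0 1) * traceZeroMap (Pi.single 1 1))
      + c • (traceZeroMap (Pi.single 0 1) * traceZeroMap (Pi.single 2 1))
      + d • (traceZeroMap (Pi.single 1 1) * traceZeroMap (Pi.single 2 1)) = M := by
  refine ⟨M 0 0 - 3 * (3 * (M 1 1 - M 0 0 + M 1 0 + M 0 1))
      - 4 * (3 * (2 * M 1 0 + 3 * M 0 1 - M 1 1 + M 0 0)) - 4 * (2 * M 1 0 - M 0 1),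
    3 * (M 1 1 - M 0 0 + M 1 0 + M 0 1), 3 * (2 * M 1 0 + 3 * M 0 1 - M 1 1 + M 0 0),
    2 * M 1 0 - M 0 1, ?_⟩
  ext i j
  fin_cases i <;> fin_cases j <;>
    simp [traceZeroMap] <;> ring_nf <;> reduce_mod_char
  ring_nf
  reduce_mod_char

/-- Let `F = ℤ/5`, `ζ` a unit of `F`, and `Q_ζ(x,y,z) = 2ζ(x² + y² + z² + xy + yz + zx)` the
quadratic form on `F³` computing the Floer cohomology of the Clifford torus. Then the even
subalgebra of the Clifford algebra `Cl(Q_ζ)` is isomorphic as an `F`-algebra to the `2×2` matrix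
algebra over `F`. -/
theorem even_clifford_iso_matrix (ζ : (ZMod 5)ˣ)
    (Q : QuadraticForm (ZMod 5) (Fin 3 → ZMod 5))
    (hQ : ∀ v : Fin 3 → ZMod 5,
      Q v = 2 * (ζ : ZMod 5) *
        (v 0 ^ 2 + v 1 ^ 2 + v 2 ^ 2 + v 0 * v 1 + v 1 * v 2 + v 2 * v 0)) :
    Nonempty (CliffordAlgebra.even Q ≃ₐ[ZMod 5] Matrix (Fin 2) (Fin 2) (ZMod 5)) := by
  let f : EvenHom Q (Matrix (Fin 2) (Fin 2) (ZMod 5)) :=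
    EvenHom.ofScaledSq (ζ : ZMod 5) traceZeroMap fun v => by
      rw [traceZeroMap_mul_self, smul_smul, hQ]
      congr 1
      ring
  have hsurj : Function.Surjective (even.lift Q f) := by
    intro M
    obtain ⟨a, b, c, d, rfl⟩ := exists_eq_combination_traceZeroMap M
    let w (i j : Fin 3) : even Q := (even.ι Q).bilin (Pi.single i 1) (Pi.single j 1)
    refine ⟨a • 1 + (↑ζ⁻¹ : ZMod 5) • (b • w 0 1 + c • w 0 2 + d • w 1 2), ?_⟩
    simp [w, f, smul_smul, mul_right_comm _ _ (ζ : ZMod 5), add_assoc]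
  have : Fact (Nat.Prime 5) := ⟨Nat.prime_five⟩
  obtain ⟨_, hrank⟩ := finite_even_and_finrank_even_le_four (K := ZMod 5) Q
  have hrank' : Module.finrank (ZMod 5) (even Q) =
      Module.finrank (ZMod 5) (Matrix (Fin 2) (Fin 2) (ZMod 5)) :=
    le_antisymm (by simpa [Module.finrank_matrix] using hrank)
      (LinearMap.finrank_le_finrank_of_surjective (f := (even.lift Q f).toLinearMap) hsurj)
  have hinj : Function.Injective (even.lift Q f) :=
    (LinearMap.injective_iff_surjective_of_finrank_eq_finrank
      (f := (even.lift Q f).toLinearMap) hrank').2 hsurj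
  exact ⟨AlgEquiv.ofBijective _ ⟨hinj, hsurj⟩⟩
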